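/- (Weighted embeddings with extra weight) Let 3 < α < 5, let w be a Lane-Emden enthalpy profile, and let p ≥ 0 and β > 0 be real. (1) If ⌈β⌉ ≥ 1, then there exists C > 0 (independent of u) such that for every smooth u : (0,R) → ℝ with finite right-hand side: (sup_{0<r<R} w(r)^{p/2} |u(r)|)² ≤ C Σ_{k=0}^{⌈β⌉+2} ∫₀^R w^{β+p+k} r⁴ |(∂_r^k u)(r)|² dr. (2) There exists C > 0 (independent of u) such that for every smooth u : (0,R) → ℝ with finite right-hand side: ∫₀^R w^p r⁴ u(r)² dr ≤ C Σ_{k=0}^{⌈β⌉} ∫₀^R w^{β+p+k} r⁴ |(∂_r^k u)(r)|² dr. -/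

import Mathlib

open MeasureTheory Real Filter Set

/-- One-dimensional Hardy inequality with power weights at the left end of `(0, L)`. -/
lemma exists_lintegral_hardy_le {q L : ℝ} (hq : -1 < q) (hL : 0 < L) :
    ∃ C : NNReal, ∀ f f' : ℝ → ℝ, (∀ x ∈ Ioc 0 L, HasDerivAt f (f' x) x) →
      ContinuousOn f' (Ioc 0 L) →
      ∫⁻ x in Ioo 0 L, ENNReal.ofReal (x ^ q * f x ^ 2) ≤
        C * ∫⁻ x in Ioo 0 L, ENNReal.ofReal (x ^ (q + 2) * (f x ^ 2 + f' x ^ 2)) := by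
  have hq1 : 0 < q + 1 := by linarith
  have hκ : 0 < (q + 1) * L / 2 := by positivity
  set κ := (q + 1) * L / 2 with hκd
  set K := (q + 2) ^ 2 / (2 * κ) + 2 * L ^ 2 / κ with hK
  have hK0 : 0 < K := by
    have : 0 < q + 2 := by linarith
    positivity
  refine ⟨(K / κ).toNNReal, fun f f' hf hf' => ?_⟩
  have hfc : ContinuousOn f (Ioc 0 L) := fun x hx => (hf x hx).continuousAt.continuousWithinAt
  have hpow : ∀ s : ℝ, ContinuousOn (fun x : ℝ => x ^ s) (Ioc 0 L) := fun s x hx =>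
    (continuousAt_rpow_const x s (Or.inl hx.1.ne')).continuousWithinAt
  have hc1 : ContinuousOn (fun x => x ^ q * f x ^ 2) (Ioc 0 L) := (hpow q).mul (hfc.pow 2)
  have hc2 : ContinuousOn (fun x => x ^ (q + 2) * (f x ^ 2 + f' x ^ 2)) (Ioc 0 L) :=
    (hpow _).mul ((hfc.pow 2).add (hf'.pow 2))
  have key : ∀ ε ∈ Ioo 0 L, ∫⁻ x in Ioc ε L, ENNReal.ofReal (x ^ q * f x ^ 2) ≤
      (K / κ).toNNReal *
        ∫⁻ x in Ioo 0 L, ENNReal.ofReal (x ^ (q + 2) * (f x ^ 2 + f' x ^ 2)) := by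
    intro ε hε
    have hsub : Icc ε L ⊆ Ioc 0 L := fun x hx => ⟨hε.1.trans_le hx.1, hx.2⟩
    have hu : uIcc ε L ⊆ Ioc 0 L := by rwa [uIcc_of_le hε.2.le]
    have hi1 := (hc1.mono hu).intervalIntegrable (μ := volume)
    have hi2 := (hc2.mono hu).intervalIntegrable (μ := volume)
    set G' : ℝ → ℝ := fun x => (((q + 1) * x ^ q) * (L - x) + x ^ (q + 1) * (-1)) * f x ^ 2 +
      (x ^ (q + 1) * (L - x)) * (2 * f x * f' x) with hG'
    have hG : ∀ x ∈ uIcc ε L,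
        HasDerivAt (fun x => (x ^ (q + 1) * (L - x)) * f x ^ 2) (G' x) x := by
      intro x hx
      have hx0 := (hu hx).1
      have h1 := Real.hasDerivAt_rpow_const (x := x) (p := q + 1) (Or.inl hx0.ne')
      have h2 : HasDerivAt (fun x => L - x) (-1) x := by
        simpa using (hasDerivAt_id x).const_sub L
      refine ((h1.mul h2).mul ((hf x (hu hx)).pow 2)).congr_deriv ?_
      simp only [hG', add_sub_cancel_right, Pi.pow_apply, Pi.mul_apply, Nat.cast_ofNat]
      norm_num
    have hG'c : ContinuousOn G' (uIcc ε L) := by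
      refine ContinuousOn.mono ?_ hu
      have hl : ContinuousOn (fun x => L - x) (Ioc 0 L) := by fun_prop
      exact (((continuousOn_const.mul (hpow q)).mul hl).add
        ((hpow (q + 1)).mul continuousOn_const)).mul (hfc.pow 2) |>.add
        (((hpow _).mul hl).mul ((continuousOn_const.mul hfc).mul hf'))
    have hFTC := intervalIntegral.integral_eq_sub_of_hasDerivAt hG hG'c.intervalIntegrable
    have hpt : ∀ x ∈ Icc ε L, κ * (x ^ q * f x ^ 2) - K * (x ^ (q + 2) * (f x ^ 2 + f' x ^ 2))
        ≤ G' x := by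
      intro x hx
      have hx0 := (hsub hx).1
      have e1 : x ^ (q + 1) = x ^ q * x := by rw [rpow_add hx0, rpow_one]
      have e2 : x ^ (q + 2) = x ^ q * x ^ 2 := by
        rw [rpow_add hx0]; norm_cast
      have hxq : 0 < x ^ q := rpow_pos_of_pos hx0 q
      have main : κ * f x ^ 2 - K * (x ^ 2 * (f x ^ 2 + f' x ^ 2)) ≤
          (q + 1) * (L - x) * f x ^ 2 - x * f x ^ 2 + 2 * x * (L - x) * f x * f' x := by
        have hqL : (q + 1) * L = 2 * κ := by rw [hκd]; ring
        have t1 : (q + 2) * x ≤ κ / 2 + (q + 2) ^ 2 / (2 * κ) * x ^ 2 := by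
          have : κ / 2 + (q + 2) ^ 2 / (2 * κ) * x ^ 2 - (q + 2) * x =
              (κ - (q + 2) * x) ^ 2 / (2 * κ) := by field_simp; ring
          have : 0 ≤ (κ - (q + 2) * x) ^ 2 / (2 * κ) := by positivity
          linarith
        have t2 : -(2 * x * (L - x) * f x * f' x) ≤
            κ / 2 * f x ^ 2 + 2 * L ^ 2 / κ * (x * f' x) ^ 2 := by
          have h0 : 0 ≤ (κ * f x + 2 * (L - x) * (x * f' x)) ^ 2 / (2 * κ) := by positivity
          have h1 : (κ * f x + 2 * (L - x) * (x * f' x)) ^ 2 / (2 * κ) =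
              κ / 2 * f x ^ 2 + 2 * x * (L - x) * f x * f' x +
                2 * (L - x) ^ 2 / κ * (x * f' x) ^ 2 := by field_simp; ring
          have h2 : 2 * (L - x) ^ 2 / κ * (x * f' x) ^ 2 ≤ 2 * L ^ 2 / κ * (x * f' x) ^ 2 := by
            have : (L - x) ^ 2 ≤ L ^ 2 := by
              apply pow_le_pow_left₀ <;> linarith [hx.2]
            gcongr
          linarith
        have t3 := mul_le_mul_of_nonneg_right t1 (sq_nonneg (f x))
        have p1 : 0 ≤ (q + 2) ^ 2 / (2 * κ) * (x * f' x) ^ 2 := by positivity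
        have p2 : 0 ≤ 2 * L ^ 2 / κ * (x * f x) ^ 2 := by positivity
        rw [hK]
        have : (q + 1) * (L - x) * f x ^ 2 = 2 * κ * f x ^ 2 - (q + 1) * x * f x ^ 2 := by
          rw [← hqL]; ring
        rw [this]
        ring_nf at t3 t2 p1 p2 ⊢
        linarith
      have := mul_le_mul_of_nonneg_left main hxq.le
      simp only [hG']
      rw [e1, e2]
      ring_nf at this ⊢
      linarith
    have hmono := intervalIntegral.integral_mono_on hε.2.le
      ((hi1.const_mul κ).sub (hi2.const_mul K)) hG'c.intervalIntegrable hpt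
    rw [hFTC, intervalIntegral.integral_sub (hi1.const_mul κ) (hi2.const_mul K),
      intervalIntegral.integral_const_mul, intervalIntegral.integral_const_mul] at hmono
    have hGε : 0 ≤ (ε ^ (q + 1) * (L - ε)) * f ε ^ 2 :=
      mul_nonneg (mul_nonneg (rpow_nonneg hε.1.le _) (by linarith [hε.2])) (sq_nonneg _)
    have hle : ∫ x in ε..L, x ^ q * f x ^ 2 ≤
        K / κ * ∫ x in ε..L, x ^ (q + 2) * (f x ^ 2 + f' x ^ 2) := by
      rw [div_mul_eq_mul_div, le_div_iff₀ hκ]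
      simp only [sub_self, mul_zero, zero_mul] at hmono
      linarith
    rw [intervalIntegral.integral_of_le hε.2.le, intervalIntegral.integral_of_le hε.2.le] at hle
    have hmem : ∀ᵐ x ∂volume.restrict (Ioc ε L), 0 < x :=
      (ae_restrict_mem measurableSet_Ioc).mono fun x hx => hε.1.trans hx.1
    calc ∫⁻ x in Ioc ε L, ENNReal.ofReal (x ^ q * f x ^ 2)
        = ENNReal.ofReal (∫ x in Ioc ε L, x ^ q * f x ^ 2) := by
          refine (ofReal_integral_eq_lintegral_ofReal hi1.1 (hmem.mono fun x hx => ?_)).symm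
          exact mul_nonneg (rpow_nonneg hx.le _) (sq_nonneg _)
      _ ≤ ENNReal.ofReal (K / κ * ∫ x in Ioc ε L, x ^ (q + 2) * (f x ^ 2 + f' x ^ 2)) :=
          ENNReal.ofReal_le_ofReal hle
      _ = (K / κ).toNNReal *
          ∫⁻ x in Ioc ε L, ENNReal.ofReal (x ^ (q + 2) * (f x ^ 2 + f' x ^ 2)) := by
          rw [ENNReal.ofReal_mul (by positivity),
            ofReal_integral_eq_lintegral_ofReal hi2.1 (hmem.mono fun x hx => ?_)]
          · rfl
          · exact mul_nonneg (rpow_nonneg hx.le _) (by positivity)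
      _ ≤ _ := by
          refine mul_le_mul' le_rfl ?_
          rw [← restrict_Ioo_eq_restrict_Ioc]
          exact lintegral_mono_set (Ioo_subset_Ioo_left hε.1.le)
  have hU : Ioo 0 L ⊆ ⋃ n : ℕ, Ioc (L / (n + 2)) L := by
    intro x hx
    obtain ⟨n, hn⟩ := exists_nat_gt (L / x)
    refine mem_iUnion.2 ⟨n, ?_, hx.2.le⟩
    rw [div_lt_iff₀ hx.1] at hn
    rw [div_lt_iff₀ (by positivity)]
    nlinarith [hx.1]
  refine (lintegral_mono_set hU).trans ?_
  rw [setLIntegral_iUnion_of_directed]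
  · refine iSup_le fun n => key _ ⟨by positivity, ?_⟩
    exact div_lt_self hL (by linarith [(Nat.cast_nonneg n : (0 : ℝ) ≤ n)])
  · refine (monotone_nat_of_le_succ fun n => Ioc_subset_Ioc_left ?_).directed_le
    gcongr
    simp

/-- The squared norm `∫₀ᴿ r ^ a (R - r) ^ q f(r) ^ 2 dr`, as an extended nonnegative real. -/
noncomputable def powWeightedSq (R a q : ℝ) (f : ℝ → ℝ) : ENNReal :=
  ∫⁻ r in Ioo 0 R, ENNReal.ofReal (r ^ a * (R - r) ^ q * f r ^ 2)

lemma continuousOn_rpow_mul_rpow (R a q : ℝ) :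
    ContinuousOn (fun r : ℝ => r ^ a * (R - r) ^ q) (Ioo 0 R) := by
  refine ContinuousOn.mul (fun x hx => ?_) (ContinuousOn.rpow_const (by fun_prop) fun x hx => ?_)
  · exact (continuousAt_rpow_const x a (Or.inl hx.1.ne')).continuousWithinAt
  · exact Or.inl (by linarith [hx.2])

lemma aemeasurable_powWeightedSq {R : ℝ} (a q : ℝ) {f : ℝ → ℝ} (hf : ContinuousOn f (Ioo 0 R)) :
    AEMeasurable (fun r => ENNReal.ofReal (r ^ a * (R - r) ^ q * f r ^ 2))
      (volume.restrict (Ioo 0 R)) :=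
  (((continuousOn_rpow_mul_rpow R a q).mul (hf.pow 2)).aemeasurable
    measurableSet_Ioo).ennreal_ofReal

lemma powWeightedSq_add {R : ℝ} (a q : ℝ) {f : ℝ → ℝ} (g : ℝ → ℝ)
    (hf : ContinuousOn f (Ioo 0 R)) :
    ∫⁻ r in Ioo 0 R, ENNReal.ofReal (r ^ a * (R - r) ^ q * (f r ^ 2 + g r ^ 2)) =
      powWeightedSq R a q f + powWeightedSq R a q g := by
  rw [powWeightedSq, powWeightedSq, ← lintegral_add_left' (aemeasurable_powWeightedSq a q hf)]
  refine setLIntegral_congr_fun measurableSet_Ioo fun r hr => ?_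
  have : 0 ≤ r ^ a * (R - r) ^ q :=
    mul_nonneg (rpow_nonneg hr.1.le _) (rpow_nonneg (by linarith [hr.2]) _)
  rw [← ENNReal.ofReal_add (by positivity) (by positivity), mul_add]

lemma powWeightedSq_le_of_le {R a q a' q' C : ℝ} (f : ℝ → ℝ) (hC : 0 ≤ C)
    (h : ∀ r ∈ Ioo 0 R, r ^ a * (R - r) ^ q ≤ C * (r ^ a' * (R - r) ^ q')) :
    powWeightedSq R a q f ≤ C.toNNReal * powWeightedSq R a' q' f := by
  rw [powWeightedSq, powWeightedSq, ← lintegral_const_mul' _ _ ENNReal.coe_ne_top]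
  refine setLIntegral_mono' measurableSet_Ioo fun r hr => ?_
  refine (ENNReal.ofReal_le_ofReal (mul_le_mul_of_nonneg_right (h r hr)
    (sq_nonneg (f r)))).trans_eq ?_
  rw [mul_assoc, ENNReal.ofReal_mul hC]
  rfl

lemma exists_powWeightedSq_le_of_le {R a q a' q' : ℝ} (ha : a' ≤ a) (hq : q' ≤ q) :
    ∃ C : NNReal, ∀ f : ℝ → ℝ, powWeightedSq R a q f ≤ C * powWeightedSq R a' q' f := by
  rcases le_or_gt R 0 with hR | hR
  · exact ⟨0, fun f => by simp [powWeightedSq, Ioo_eq_empty_of_le hR]⟩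
  refine ⟨_, fun f => powWeightedSq_le_of_le (C := R ^ (a - a') * R ^ (q - q')) f
    (by positivity) fun r hr => ?_⟩
  have hd : 0 < R - r := by linarith [hr.2]
  have h1 : r ^ a = r ^ (a - a') * r ^ a' := by rw [← rpow_add hr.1]; simp
  have h2 : (R - r) ^ q = (R - r) ^ (q - q') * (R - r) ^ q' := by rw [← rpow_add hd]; simp
  have h3 : r ^ (a - a') ≤ R ^ (a - a') := rpow_le_rpow hr.1.le hr.2.le (by linarith)
  have h4 : (R - r) ^ (q - q') ≤ R ^ (q - q') :=
    rpow_le_rpow hd.le (by linarith [hr.1]) (by linarith)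
  have h5 := rpow_nonneg hr.1.le a'
  have h6 := rpow_nonneg hd.le q'
  have h7 := rpow_nonneg hr.1.le (a - a')
  have h8 := rpow_nonneg hd.le (q - q')
  calc r ^ a * (R - r) ^ q
      = (r ^ (a - a') * (R - r) ^ (q - q')) * (r ^ a' * (R - r) ^ q') := by rw [h1, h2]; ring
    _ ≤ _ := by gcongr

lemma rpow_le_rpow_add_rpow {x y z : ℝ} (s : ℝ) (hx : 0 < x) (hxy : x ≤ y) (hyz : y ≤ z) :
    y ^ s ≤ x ^ s + z ^ s := by
  have hy := hx.trans_le hxy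
  rcases le_total 0 s with hs | hs
  · linarith [rpow_le_rpow hy.le hyz hs, rpow_nonneg hx.le s]
  · linarith [rpow_le_rpow_of_nonpos hx hxy hs, rpow_nonneg (hy.trans_le hyz).le s]

lemma powWeightedSq_comp_const_sub (R a q : ℝ) (f : ℝ → ℝ) :
    powWeightedSq R q a (fun r => f (R - r)) = powWeightedSq R a q f := by
  rw [powWeightedSq, powWeightedSq, ← lintegral_indicator measurableSet_Ioo,
    ← lintegral_indicator measurableSet_Ioo, ← lintegral_sub_left_eq_self _ R]
  refine lintegral_congr fun r => ?_
  by_cases hr : r ∈ Ioo 0 R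
  · have hr' : R - r ∈ Ioo 0 R := ⟨by linarith [hr.2], by linarith [hr.1]⟩
    rw [indicator_of_mem hr, indicator_of_mem hr', sub_sub_cancel, mul_comm (r ^ a)]
  · have hr' : R - r ∉ Ioo 0 R := fun h => hr ⟨by linarith [h.2], by linarith [h.1]⟩
    rw [indicator_of_notMem hr, indicator_of_notMem hr']

lemma ContDiffOn.deriv_Ioo {f : ℝ → ℝ} {a b : ℝ} (hf : ContDiffOn ℝ (⊤ : ℕ∞) f (Ioo a b)) :
    ContDiffOn ℝ (⊤ : ℕ∞) (deriv f) (Ioo a b) :=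
  hf.deriv_of_isOpen isOpen_Ioo (by simp)

lemma ContDiffOn.hasDerivAt_Ioo {f : ℝ → ℝ} {a b : ℝ} (hf : ContDiffOn ℝ (⊤ : ℕ∞) f (Ioo a b))
    {x : ℝ} (hx : x ∈ Ioo a b) : HasDerivAt f (deriv f x) x :=
  ((hf.differentiableOn (by simp)).differentiableAt (Ioo_mem_nhds hx.1 hx.2)).hasDerivAt

/-- Hardy inequality at the left end: a derivative gains two powers of `r`. -/
lemma exists_powWeightedSq_hardy_left {R a : ℝ} (q : ℝ) (hR : 0 < R) (ha : -1 < a) :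
    ∃ C : NNReal, ∀ f : ℝ → ℝ, ContDiffOn ℝ (⊤ : ℕ∞) f (Ioo 0 R) →
      powWeightedSq R a q f ≤
        C * (powWeightedSq R (a + 2) q f + powWeightedSq R (a + 2) q (deriv f)) := by
  have hL : 0 < R / 2 := by linarith
  set L := R / 2 with hLd
  obtain ⟨C, hC⟩ := exists_lintegral_hardy_le ha hL
  set A := L ^ q + R ^ q
  set B := L ^ (-q) + R ^ (-q)
  have hA : 0 ≤ A := by positivity
  have hB : 0 ≤ B := by positivity
  refine ⟨A.toNNReal * (C * B.toNNReal) + (L ^ 2)⁻¹.toNNReal, fun f hf => ?_⟩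
  rw [← powWeightedSq_add (a + 2) q _ hf.continuousOn]
  set W := ∫⁻ r in Ioo 0 R, ENNReal.ofReal (r ^ (a + 2) * (R - r) ^ q * (f r ^ 2 + deriv f r ^ 2))
    with hW
  have hsub : Ioc 0 L ⊆ Ioo 0 R := fun x hx => ⟨hx.1, by linarith [hx.2]⟩
  have hleft : ∫⁻ r in Ioo 0 L, ENNReal.ofReal (r ^ a * (R - r) ^ q * f r ^ 2) ≤
      A.toNNReal * (C * (B.toNNReal * W)) := by
    calc ∫⁻ r in Ioo 0 L, ENNReal.ofReal (r ^ a * (R - r) ^ q * f r ^ 2)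
        ≤ ∫⁻ r in Ioo 0 L, A.toNNReal * ENNReal.ofReal (r ^ a * f r ^ 2) := by
          refine setLIntegral_mono' measurableSet_Ioo fun r hr => ?_
          change _ ≤ ENNReal.ofReal A * _
          rw [← ENNReal.ofReal_mul hA]
          apply ENNReal.ofReal_le_ofReal
          have h1 : (R - r) ^ q ≤ A :=
            rpow_le_rpow_add_rpow q hL (by linarith [hr.2]) (by linarith [hr.1])
          have h2 := mul_nonneg (rpow_nonneg hr.1.le a) (sq_nonneg (f r))
          nlinarith [mul_le_mul_of_nonneg_right h1 h2]
      _ = A.toNNReal * ∫⁻ r in Ioo 0 L, ENNReal.ofReal (r ^ a * f r ^ 2) :=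
          lintegral_const_mul' _ _ ENNReal.coe_ne_top
      _ ≤ A.toNNReal * (C * ∫⁻ r in Ioo 0 L,
            ENNReal.ofReal (r ^ (a + 2) * (f r ^ 2 + deriv f r ^ 2))) :=
          mul_le_mul' le_rfl (hC f (deriv f) (fun x hx => hf.hasDerivAt_Ioo (hsub hx))
            (hf.deriv_Ioo.continuousOn.mono hsub))
      _ ≤ A.toNNReal * (C * (B.toNNReal * W)) := by
          refine mul_le_mul' le_rfl (mul_le_mul' le_rfl ?_)
          rw [hW, ← lintegral_const_mul' _ _ ENNReal.coe_ne_top]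
          refine le_trans ?_ (lintegral_mono_set (Ioo_subset_Ioo_right (by linarith : L ≤ R)))
          refine setLIntegral_mono' measurableSet_Ioo fun r hr => ?_
          change _ ≤ ENNReal.ofReal B * _
          rw [← ENNReal.ofReal_mul hB]
          apply ENNReal.ofReal_le_ofReal
          have hd : 0 < R - r := by linarith [hr.2]
          have h1 : (R - r) ^ (-q) ≤ B :=
            rpow_le_rpow_add_rpow (-q) hL (by linarith [hr.2]) (by linarith [hr.1])
          have h2 : 1 ≤ B * (R - r) ^ q := by
            calc (1 : ℝ) = (R - r) ^ (-q) * (R - r) ^ q := by rw [← rpow_add hd]; simp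
              _ ≤ _ := by gcongr
          have h3 : 0 ≤ r ^ (a + 2) * (f r ^ 2 + deriv f r ^ 2) :=
            mul_nonneg (rpow_nonneg hr.1.le _) (by positivity)
          nlinarith [mul_le_mul_of_nonneg_right h2 h3]
  have hright : ∫⁻ r in Ico L R, ENNReal.ofReal (r ^ a * (R - r) ^ q * f r ^ 2) ≤
      (L ^ 2)⁻¹.toNNReal * W := by
    rw [hW, ← lintegral_const_mul' _ _ ENNReal.coe_ne_top]
    refine le_trans ?_ (lintegral_mono_set (fun x hx => ⟨hL.trans_le hx.1, hx.2⟩ :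
      Ico L R ⊆ Ioo 0 R))
    refine setLIntegral_mono' measurableSet_Ico fun r hr => ?_
    change _ ≤ ENNReal.ofReal (L ^ 2)⁻¹ * _
    rw [← ENNReal.ofReal_mul (by positivity)]
    apply ENNReal.ofReal_le_ofReal
    have hr0 : 0 < r := hL.trans_le hr.1
    have hd : 0 ≤ (R - r) ^ q := rpow_nonneg (by linarith [hr.2]) _
    have e2 : r ^ (a + 2) = r ^ a * r ^ 2 := by rw [rpow_add hr0]; norm_cast
    have h1 : 1 ≤ (L ^ 2)⁻¹ * r ^ 2 := by
      rw [inv_mul_eq_div, one_le_div (by positivity)]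
      exact pow_le_pow_left₀ hL.le hr.1 2
    calc r ^ a * (R - r) ^ q * f r ^ 2 = 1 * (r ^ a * (R - r) ^ q * f r ^ 2) := by ring
      _ ≤ ((L ^ 2)⁻¹ * r ^ 2) * (r ^ a * (R - r) ^ q * (f r ^ 2 + deriv f r ^ 2)) := by
          gcongr
          linarith [sq_nonneg (deriv f r)]
      _ = _ := by rw [e2]; ring
  have hU : Ioo 0 R ⊆ Ioo 0 L ∪ Ico L R := fun x hx =>
    (lt_or_ge x L).imp (fun h => ⟨hx.1, h⟩) fun h => ⟨h, hx.2⟩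
  calc powWeightedSq R a q f ≤ _ := lintegral_mono_set hU
    _ ≤ _ := lintegral_union_le _ _ _
    _ ≤ A.toNNReal * (C * (B.toNNReal * W)) + (L ^ 2)⁻¹.toNNReal * W := add_le_add hleft hright
    _ = _ := by push_cast; ring

/-- Hardy inequality at the right end: a derivative gains two powers of `R - r`. -/
lemma exists_powWeightedSq_hardy_right {R q : ℝ} (a : ℝ) (hR : 0 < R) (hq : -1 < q) :
    ∃ C : NNReal, ∀ f : ℝ → ℝ, ContDiffOn ℝ (⊤ : ℕ∞) f (Ioo 0 R) →
      powWeightedSq R a q f ≤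
        C * (powWeightedSq R a (q + 2) f + powWeightedSq R a (q + 2) (deriv f)) := by
  obtain ⟨C, hC⟩ := exists_powWeightedSq_hardy_left a hR hq
  refine ⟨C, fun f hf => ?_⟩
  have hmaps : MapsTo (fun r => R - r) (Ioo 0 R) (Ioo 0 R) := fun r hr =>
    ⟨by linarith [hr.2], by linarith [hr.1]⟩
  have h := hC (fun r => f (R - r)) (hf.comp (by fun_prop) hmaps)
  rw [powWeightedSq_comp_const_sub, powWeightedSq_comp_const_sub] at h
  have hd : powWeightedSq R (q + 2) a (deriv fun r => f (R - r)) =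
      powWeightedSq R a (q + 2) (deriv f) := by
    rw [← powWeightedSq_comp_const_sub]
    refine lintegral_congr fun r => ?_
    simp only [deriv_comp_const_sub, sub_sub_cancel, neg_sq]
  rwa [hd] at h

/-- The sum of weighted squared norms of the derivatives of order less than `N`. -/
noncomputable def powWeightedEnergy (R s : ℝ) (N : ℕ) (f : ℝ → ℝ) : ENNReal :=
  ∑ k ∈ Finset.range N, powWeightedSq R 4 (s + k) (iteratedDeriv k f)

lemma powWeightedSq_le_energy (R s : ℝ) {N k : ℕ} (hk : k < N) (f : ℝ → ℝ) :
    powWeightedSq R 4 (s + k) (iteratedDeriv k f) ≤ powWeightedEnergy R s N f :=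
  Finset.single_le_sum (f := fun k : ℕ => powWeightedSq R 4 (s + k) (iteratedDeriv k f))
    (fun _ _ => zero_le) (Finset.mem_range.2 hk)

lemma powWeightedEnergy_mono (R s : ℝ) {M N : ℕ} (h : M ≤ N) (f : ℝ → ℝ) :
    powWeightedEnergy R s M f ≤ powWeightedEnergy R s N f :=
  Finset.sum_le_sum_of_subset (Finset.range_subset_range.2 h)

lemma powWeightedEnergy_deriv_le (R s : ℝ) (N : ℕ) (f : ℝ → ℝ) :
    powWeightedEnergy R (s + 1) N (deriv f) ≤ powWeightedEnergy R s (N + 1) f := by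
  rw [powWeightedEnergy, powWeightedEnergy, Finset.sum_range_succ']
  refine (Finset.sum_le_sum fun k _ => ?_).trans le_self_add
  rw [iteratedDeriv_succ']
  push_cast
  rw [add_assoc, add_comm (1 : ℝ)]

/-- Iterated Hardy inequality at the right end. -/
lemma exists_powWeightedSq_le_energy {R : ℝ} (hR : 0 < R) (n : ℕ) :
    ∀ s : ℝ, -1 < s - n → ∃ C : NNReal, ∀ f : ℝ → ℝ, ContDiffOn ℝ (⊤ : ℕ∞) f (Ioo 0 R) →
      powWeightedSq R 4 (s - n) f ≤ C * powWeightedEnergy R s (n + 1) f := by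
  induction n with
  | zero => exact fun s _ => ⟨1, fun f _ => by simp [powWeightedEnergy]⟩
  | succ n ih =>
    intro s hs
    push_cast at hs
    obtain ⟨C₁, h₁⟩ := exists_powWeightedSq_hardy_right 4 hR hs
    obtain ⟨C₂, h₂⟩ := ih (s + 1) (by linarith)
    have hmono : ∀ k : ℕ, ∃ C : NNReal, ∀ f : ℝ → ℝ,
        powWeightedSq R 4 (s + 1 + k) f ≤ C * powWeightedSq R 4 (s + k) f := fun k =>
      exists_powWeightedSq_le_of_le le_rfl (by linarith)
    choose D hD using hmono
    refine ⟨C₁ * (C₂ * (∑ k ∈ Finset.range (n + 1), D k) + C₂), fun f hf => ?_⟩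
    have e : s - (n + 1) + 2 = s + 1 - n := by ring
    set S := powWeightedEnergy R s (n + 1 + 1) f
    have hf0 : powWeightedSq R 4 (s + 1 - n) f ≤
        C₂ * (∑ k ∈ Finset.range (n + 1), D k : NNReal) * S := by
      refine (h₂ f hf).trans ?_
      rw [mul_assoc]
      refine mul_le_mul' le_rfl ?_
      push_cast
      rw [Finset.sum_mul]
      exact Finset.sum_le_sum fun k hk => (hD k _).trans (mul_le_mul' le_rfl
        (powWeightedSq_le_energy R s ((Finset.mem_range.1 hk).trans (Nat.lt_succ_self _)) f))
    have hf1 : powWeightedSq R 4 (s + 1 - n) (deriv f) ≤ C₂ * S :=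
      (h₂ (deriv f) hf.deriv_Ioo).trans
        (mul_le_mul' le_rfl (powWeightedEnergy_deriv_le R s (n + 1) f))
    push_cast
    refine (h₁ f hf).trans ?_
    rw [e]
    calc C₁ * (powWeightedSq R 4 (s + 1 - n) f + powWeightedSq R 4 (s + 1 - n) (deriv f))
        ≤ C₁ * (C₂ * (∑ k ∈ Finset.range (n + 1), D k : NNReal) * S + C₂ * S) := by gcongr
      _ = _ := by push_cast; ring

/-- `F` is bounded by a constant multiple of `G`, uniformly over smooth functions on `(0, R)`. -/
abbrev DominatedOnSmooth (R : ℝ) (F G : (ℝ → ℝ) → ENNReal) : Prop :=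
  ∃ C : NNReal, ∀ f : ℝ → ℝ, ContDiffOn ℝ (⊤ : ℕ∞) f (Ioo 0 R) → F f ≤ C * G f

namespace DominatedOnSmooth

variable {R : ℝ} {F G H : (ℝ → ℝ) → ENNReal}

lemma trans (h₁ : DominatedOnSmooth R F G) (h₂ : DominatedOnSmooth R G H) :
    DominatedOnSmooth R F H := by
  obtain ⟨C₁, h₁⟩ := h₁
  obtain ⟨C₂, h₂⟩ := h₂
  refine ⟨C₁ * C₂, fun f hf => (h₁ f hf).trans ?_⟩
  rw [ENNReal.coe_mul, mul_assoc]
  exact mul_le_mul' le_rfl (h₂ f hf)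

lemma add (h₁ : DominatedOnSmooth R F H) (h₂ : DominatedOnSmooth R G H) :
    DominatedOnSmooth R (fun f => F f + G f) H := by
  obtain ⟨C₁, h₁⟩ := h₁
  obtain ⟨C₂, h₂⟩ := h₂
  refine ⟨C₁ + C₂, fun f hf => ?_⟩
  rw [ENNReal.coe_add, add_mul]
  exact add_le_add (h₁ f hf) (h₂ f hf)

lemma comp_deriv (h : DominatedOnSmooth R F G) :
    DominatedOnSmooth R (fun f => F (deriv f)) (fun f => G (deriv f)) :=
  h.imp fun _ hC f hf => hC (deriv f) hf.deriv_Ioo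

lemma of_le (h : ∀ f, F f ≤ G f) : DominatedOnSmooth R F G :=
  ⟨1, fun f _ => by simpa using h f⟩

end DominatedOnSmooth

/-- Two applications of Hardy inequality at the left end. -/
lemma dominatedOnSmooth_hardy_left_two {R : ℝ} (q : ℝ) (hR : 0 < R) :
    DominatedOnSmooth R (powWeightedSq R 0 q)
      (fun f => powWeightedSq R 4 q f + powWeightedSq R 4 q (deriv f) +
        powWeightedSq R 4 q (deriv (deriv f))) := by
  have k₀ : DominatedOnSmooth R _ _ :=
    exists_powWeightedSq_hardy_left q hR (by norm_num : (-1 : ℝ) < 0)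
  have k₂ : DominatedOnSmooth R _ _ :=
    exists_powWeightedSq_hardy_left q hR (by norm_num : (-1 : ℝ) < 0 + 2)
  rw [show (0 : ℝ) + 2 + 2 = 4 by norm_num] at k₂
  refine k₀.trans ((k₂.trans (.of_le fun f => le_self_add)).add
    (k₂.comp_deriv.trans (.of_le fun f => ?_)))
  rw [add_assoc]
  exact le_add_self

/-- The weight `(R - r) ^ p` is controlled by its parts away from the two ends. -/
lemma dominatedOnSmooth_interpolate {R p Q : ℝ} (hR : 0 < R) (hQ : p ≤ Q) :
    DominatedOnSmooth R (powWeightedSq R 0 p)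
      (fun f => powWeightedSq R 0 Q f + powWeightedSq R 4 p f) := by
  have hL : 0 < R / 2 := by linarith
  set c := ((R / 2) ^ (Q - p))⁻¹ + ((R / 2) ^ (4 : ℝ))⁻¹ with hc
  have hc0 : 0 ≤ c := by positivity
  have hc1 : 1 ≤ c * (R / 2) ^ (Q - p) := by
    rw [hc, add_mul, inv_mul_cancel₀ (by positivity)]
    exact le_add_of_nonneg_right (by positivity)
  have hc2 : 1 ≤ c * (R / 2) ^ (4 : ℝ) := by
    rw [hc, add_mul, inv_mul_cancel₀ (a := (R / 2) ^ (4 : ℝ)) (by positivity)]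
    exact le_add_of_nonneg_left (by positivity)
  refine ⟨c.toNNReal, fun f hf => ?_⟩
  simp only [powWeightedSq]
  rw [← lintegral_add_left' (aemeasurable_powWeightedSq 0 Q hf.continuousOn),
    ← lintegral_const_mul' _ _ ENNReal.coe_ne_top]
  refine setLIntegral_mono' measurableSet_Ioo fun r hr => ?_
  have hd : 0 < R - r := by linarith [hr.2]
  have hr0 := hr.1
  have hdp : 0 ≤ (R - r) ^ p * f r ^ 2 := mul_nonneg (rpow_nonneg hd.le _) (sq_nonneg _)
  change _ ≤ ENNReal.ofReal c * _
  rw [← ENNReal.ofReal_add (by positivity) (by positivity), ← ENNReal.ofReal_mul hc0]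
  apply ENNReal.ofReal_le_ofReal
  rw [rpow_zero, one_mul, one_mul]
  have e : (R - r) ^ Q = (R - r) ^ (Q - p) * (R - r) ^ p := by rw [← rpow_add hd]; simp
  rw [e]
  have key : 1 ≤ c * (R - r) ^ (Q - p) + c * r ^ (4 : ℝ) := by
    have h1 : 0 ≤ c * (R - r) ^ (Q - p) := by positivity
    have h2 : 0 ≤ c * r ^ (4 : ℝ) := by positivity
    rcases le_total r (R / 2) with h | h
    · have : (R / 2) ^ (Q - p) ≤ (R - r) ^ (Q - p) :=
        rpow_le_rpow hL.le (by linarith) (by linarith)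
      nlinarith [mul_le_mul_of_nonneg_left this hc0]
    · have : (R / 2) ^ (4 : ℝ) ≤ r ^ (4 : ℝ) := rpow_le_rpow hL.le h (by norm_num)
      nlinarith [mul_le_mul_of_nonneg_left this hc0]
  nlinarith [mul_le_mul_of_nonneg_right key hdp]

/-- One-dimensional Sobolev embedding with the weight `(R - r) ^ p`. -/
lemma exists_rpow_mul_sq_le {R p : ℝ} (hR : 0 < R) (hp : 0 ≤ p) :
    ∃ C : NNReal, ∀ f : ℝ → ℝ, ContDiffOn ℝ (⊤ : ℕ∞) f (Ioo 0 R) → ∀ r ∈ Ioo 0 R,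
      ENNReal.ofReal ((R - r) ^ p * f r ^ 2) ≤
        C * (powWeightedSq R 0 p f + powWeightedSq R 0 p (deriv f)) := by
  have hL : 0 < R / 2 := by linarith
  refine ⟨(2 ^ p * ((R / 2)⁻¹ + 1)).toNNReal, fun f hf r hr => ?_⟩
  set T := powWeightedSq R 0 p f + powWeightedSq R 0 p (deriv f) with hT
  set X := ENNReal.ofReal ((R - r) ^ p * f r ^ 2)
  have hfc := hf.continuousOn
  have hfc' := hf.deriv_Ioo.continuousOn
  have hdr : 0 ≤ R - r := by linarith [hr.2]
  have key : ∀ y ∈ Ioo 0 (R / 2), X ≤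
      ENNReal.ofReal (2 ^ p) * (ENNReal.ofReal (y ^ (0 : ℝ) * (R - y) ^ p * f y ^ 2) + T) := by
    intro y hy
    have hyR : y ∈ Ioo 0 R := ⟨hy.1, by linarith [hy.2]⟩
    have hsub : uIcc y r ⊆ Ioo 0 R := ordConnected_Ioo.uIcc_subset hyR hr
    have hsub' : uIoc y r ⊆ Ioo 0 R := uIoc_subset_uIcc.trans hsub
    have hw : ∀ s ∈ uIcc y r, (R - r) ^ p ≤ 2 ^ p * (R - s) ^ p := by
      intro s hs
      have hsR := hsub hs
      rw [← mul_rpow (by norm_num) (by linarith [hsR.2])]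
      refine rpow_le_rpow hdr ?_ hp
      rcases le_total y r with h | h
      · rw [uIcc_of_le h] at hs
        linarith [hs.2, hsR.2]
      · rw [uIcc_of_ge h] at hs
        linarith [hs.2, hy.2, hr.1]
    have hder : ∀ x ∈ uIcc y r, HasDerivAt (fun x => f x ^ 2) (2 * f x * deriv f x) x := by
      intro x hx
      refine ((hf.hasDerivAt_Ioo (hsub hx)).pow 2).congr_deriv ?_
      norm_num
    have hc : ContinuousOn (fun x => 2 * f x * deriv f x) (uIcc y r) :=
      ((continuousOn_const.mul hfc).mul hfc').mono hsub
    have hFTC := intervalIntegral.integral_eq_sub_of_hasDerivAt hder hc.intervalIntegrable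
    have hnorm := (le_abs_self _).trans
      (intervalIntegral.norm_integral_le_integral_norm_uIoc (μ := volume) (a := y) (b := r)
        (f := fun x => 2 * f x * deriv f x))
    rw [hFTC] at hnorm
    set g : ℝ → ℝ := fun s => s ^ (0 : ℝ) * (R - s) ^ p * (f s ^ 2 + deriv f s ^ 2) with hg
    have hgc : ContinuousOn g (uIcc y r) :=
      ((continuousOn_rpow_mul_rpow R 0 p).mul ((hfc.pow 2).add (hfc'.pow 2))).mono hsub
    have hgi : IntegrableOn g (uIoc y r) :=
      (hgc.integrableOn_compact isCompact_uIcc).mono_set uIoc_subset_uIcc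
    have hni : IntegrableOn (fun x => ‖2 * f x * deriv f x‖) (uIoc y r) :=
      (hc.norm.integrableOn_compact isCompact_uIcc).mono_set uIoc_subset_uIcc
    have hint : (R - r) ^ p * ∫ x in uIoc y r, ‖2 * f x * deriv f x‖ ≤
        2 ^ p * ∫ x in uIoc y r, g x := by
      rw [← integral_const_mul, ← integral_const_mul]
      refine setIntegral_mono_on (hni.const_mul _) (hgi.const_mul _) measurableSet_uIoc
        fun s hs => ?_
      have h1 : ‖2 * f s * deriv f s‖ ≤ f s ^ 2 + deriv f s ^ 2 := by
        rw [Real.norm_eq_abs, abs_le]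
        constructor <;> nlinarith [sq_nonneg (f s + deriv f s), sq_nonneg (f s - deriv f s)]
      calc (R - r) ^ p * ‖2 * f s * deriv f s‖
          ≤ (2 ^ p * (R - s) ^ p) * (f s ^ 2 + deriv f s ^ 2) :=
            mul_le_mul (hw s (uIoc_subset_uIcc hs)) h1 (norm_nonneg _)
              ((rpow_nonneg hdr p).trans (hw s (uIoc_subset_uIcc hs)))
        _ = 2 ^ p * g s := by simp only [hg, rpow_zero]; ring
    have hgT : ENNReal.ofReal (∫ x in uIoc y r, g x) ≤ T := by
      rw [ofReal_integral_eq_lintegral_ofReal hgi, hT, ← powWeightedSq_add 0 p _ hfc]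
      · exact lintegral_mono_set hsub'
      · refine (ae_restrict_mem measurableSet_uIoc).mono fun s hs => ?_
        have := hsub' hs
        exact mul_nonneg (mul_nonneg (rpow_nonneg this.1.le _)
          (rpow_nonneg (by linarith [this.2]) _)) (by positivity)
    have hy0 : 0 ≤ y ^ (0 : ℝ) * (R - y) ^ p * f y ^ 2 :=
      mul_nonneg (mul_nonneg (rpow_nonneg hy.1.le _)
        (rpow_nonneg (by linarith [hyR.2]) _)) (by positivity)
    calc X ≤ ENNReal.ofReal (2 ^ p * (y ^ (0 : ℝ) * (R - y) ^ p * f y ^ 2 +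
            ∫ x in uIoc y r, g x)) := by
          apply ENNReal.ofReal_le_ofReal
          rw [rpow_zero, one_mul]
          have h1 := mul_le_mul_of_nonneg_left hnorm (rpow_nonneg hdr p)
          have h2 := mul_le_mul_of_nonneg_right (hw y left_mem_uIcc) (sq_nonneg (f y))
          rw [mul_sub] at h1
          linarith
      _ ≤ _ := by
          rw [ENNReal.ofReal_mul (by positivity)]
          exact mul_le_mul' le_rfl (ENNReal.ofReal_add_le.trans (add_le_add le_rfl hgT))
  have havg : ENNReal.ofReal (R / 2) * X ≤
      ENNReal.ofReal (2 ^ p) * (T + ENNReal.ofReal (R / 2) * T) := by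
    have hvol : volume (Ioo 0 (R / 2)) = ENNReal.ofReal (R / 2) := by simp
    calc ENNReal.ofReal (R / 2) * X = ∫⁻ _ in Ioo 0 (R / 2), X := by
          rw [setLIntegral_const, hvol, mul_comm]
      _ ≤ ∫⁻ y in Ioo 0 (R / 2), ENNReal.ofReal (2 ^ p) *
            (ENNReal.ofReal (y ^ (0 : ℝ) * (R - y) ^ p * f y ^ 2) + T) :=
          setLIntegral_mono' measurableSet_Ioo key
      _ = ENNReal.ofReal (2 ^ p) *
            ((∫⁻ y in Ioo 0 (R / 2), ENNReal.ofReal (y ^ (0 : ℝ) * (R - y) ^ p * f y ^ 2)) +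
              ENNReal.ofReal (R / 2) * T) := by
          rw [lintegral_const_mul' _ _ ENNReal.ofReal_ne_top, lintegral_add_right _ (by fun_prop),
            setLIntegral_const, hvol, mul_comm T]
      _ ≤ _ := by
          refine mul_le_mul' le_rfl (add_le_add ?_ le_rfl)
          exact (lintegral_mono_set (Ioo_subset_Ioo_right (by linarith))).trans le_self_add
  have hone : ENNReal.ofReal (R / 2)⁻¹ * ENNReal.ofReal (R / 2) = 1 := by
    rw [← ENNReal.ofReal_mul (by positivity), inv_mul_cancel₀ hL.ne', ENNReal.ofReal_one]
  calc X = ENNReal.ofReal (R / 2)⁻¹ * (ENNReal.ofReal (R / 2) * X) := by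
        rw [← mul_assoc, hone, one_mul]
    _ ≤ ENNReal.ofReal (R / 2)⁻¹ * (ENNReal.ofReal (2 ^ p) * (T + ENNReal.ofReal (R / 2) * T)) :=
        mul_le_mul' le_rfl havg
    _ = ENNReal.ofReal (2 ^ p) * (ENNReal.ofReal (R / 2)⁻¹ * T +
          (ENNReal.ofReal (R / 2)⁻¹ * ENNReal.ofReal (R / 2)) * T) := by ring
    _ = ENNReal.ofReal (2 ^ p * ((R / 2)⁻¹ + 1)) * T := by
        rw [hone, ENNReal.ofReal_mul (by positivity), ENNReal.ofReal_add (by positivity) (by simp),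
          ENNReal.ofReal_one]
        ring
    _ = _ := rfl

lemma dominatedOnSmooth_powWeightedSq_energy {R s p : ℝ} {n : ℕ} (hR : 0 < R)
    (hs : -1 < s - n) (hp : s - n ≤ p) :
    DominatedOnSmooth R (powWeightedSq R 4 p) (powWeightedEnergy R s (n + 1)) := by
  obtain ⟨C, hC⟩ := exists_powWeightedSq_le_of_le (R := R) (le_refl (4 : ℝ)) hp
  exact DominatedOnSmooth.trans ⟨C, fun f _ => hC f⟩ (exists_powWeightedSq_le_energy hR n s hs)

lemma exists_rpow_mul_sq_le_energy {R s p : ℝ} {n : ℕ} (hR : 0 < R) (hn : 1 ≤ n) (hp : 0 ≤ p)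
    (hps : p ≤ s) (hs : -1 < s - n) (hsp : s - n ≤ p) :
    ∃ C : NNReal, ∀ f : ℝ → ℝ, ContDiffOn ℝ (⊤ : ℕ∞) f (Ioo 0 R) → ∀ r ∈ Ioo 0 R,
      ENNReal.ofReal ((R - r) ^ p * f r ^ 2) ≤ C * powWeightedEnergy R s (n + 3) f := by
  set E := powWeightedEnergy R s (n + 3)
  have h0 : DominatedOnSmooth R (powWeightedSq R 4 p) E :=
    (dominatedOnSmooth_powWeightedSq_energy hR hs hsp).trans
      (.of_le (powWeightedEnergy_mono R s (by omega)))
  have h1 : DominatedOnSmooth R (fun f => powWeightedSq R 4 p (deriv f)) E := by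
    have := dominatedOnSmooth_powWeightedSq_energy (s := s + 1) (n := n + 1) (p := p) hR
      (by push_cast; linarith) (by push_cast; linarith)
    exact this.comp_deriv.trans (.of_le (powWeightedEnergy_deriv_le R s (n + 2)))
  have hk : ∀ k : ℕ, k ≤ 3 →
      DominatedOnSmooth R (fun f => powWeightedSq R 4 (s + 3) (iteratedDeriv k f)) E := by
    intro k hk
    have hk' : (k : ℝ) ≤ 3 := by exact_mod_cast hk
    obtain ⟨C, hC⟩ := exists_powWeightedSq_le_of_le (R := R) (le_refl (4 : ℝ))
      (by linarith : s + k ≤ s + 3)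
    exact DominatedOnSmooth.trans ⟨C, fun f _ => hC (iteratedDeriv k f)⟩
      (.of_le (powWeightedSq_le_energy R s (by omega)))
  have k0 := hk 0 (by norm_num)
  have k1 := hk 1 (by norm_num)
  have k2 := hk 2 (by norm_num)
  have k3 := hk 3 (by norm_num)
  simp only [iteratedDeriv_succ', iteratedDeriv_zero] at k0 k1 k2 k3
  have i := dominatedOnSmooth_interpolate hR (by linarith : p ≤ s + 3)
  have l := dominatedOnSmooth_hardy_left_two (s + 3) hR
  have m0 : DominatedOnSmooth R (powWeightedSq R 0 p) E :=
    i.trans ((l.trans ((k0.add k1).add k2)).add h0)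
  have m1 : DominatedOnSmooth R (fun f => powWeightedSq R 0 p (deriv f)) E :=
    i.comp_deriv.trans ((l.comp_deriv.trans ((k1.add k2).add k3)).add h1)
  obtain ⟨A, hA⟩ := exists_rpow_mul_sq_le hR hp
  obtain ⟨B, hB⟩ := m0.add m1
  refine ⟨A * B, fun f hf r hr => (hA f hf r hr).trans ?_⟩
  rw [ENNReal.coe_mul, mul_assoc]
  exact mul_le_mul' le_rfl (hB f hf)

/-- A profile with a nonzero one-sided slope at `R` is comparable to the distance to `R`. -/
lemma exists_bounds_of_tendsto_deriv {R : ℝ} (hR : 0 < R) {w : ℝ → ℝ} {w'R : ℝ}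
    (hw_cont : ContinuousOn w (Icc 0 R)) (hw_diff : DifferentiableOn ℝ w (Ioo 0 R))
    (hw_pos : ∀ r, 0 ≤ r → r < R → 0 < w r) (hwR : w R = 0) (hneg : w'R < 0)
    (hlim : Tendsto (deriv w) (nhdsWithin R (Iio R)) (nhds w'R)) :
    ∃ m > 0, ∃ M > 0, ∀ r ∈ Ioo 0 R, m * (R - r) ≤ w r ∧ w r ≤ M * (R - r) := by
  have hcw : ContinuousWithinAt w (Ioo 0 R) R :=
    (hw_cont R (right_mem_Icc.2 hR.le)).mono Ioo_subset_Icc_self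
  have hder := hasDerivWithinAt_Iic_of_tendsto_deriv hw_diff hcw (Ioo_mem_nhdsLT hR) hlim
  rw [hasDerivWithinAt_iff_tendsto_slope, Iic_sdiff_right] at hder
  have hev : ∀ᶠ r in nhdsWithin R (Iio R), slope w R r ∈ Ioo (2 * w'R) (w'R / 2) :=
    hder.eventually (Ioo_mem_nhds (by linarith) (by linarith))
  obtain ⟨l, hl, hlsub⟩ := (mem_nhdsLT_iff_exists_Ioo_subset' hR).1 (hev.and (Ioo_mem_nhdsLT hR))
  have hlR : l < R := hl
  set l' := max l 0
  have hl'R : l' < R := max_lt hlR hR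
  have hl'0 : 0 ≤ l' := le_max_right _ _
  have hsub : Icc 0 l' ⊆ Icc 0 R := Icc_subset_Icc_right hl'R.le
  have hne : (Icc 0 l').Nonempty := ⟨0, left_mem_Icc.2 hl'0⟩
  obtain ⟨x, hx, hxmin⟩ := isCompact_Icc.exists_isMinOn hne (hw_cont.mono hsub)
  obtain ⟨y, hy, hymax⟩ := isCompact_Icc.exists_isMaxOn hne (hw_cont.mono hsub)
  have hwx : 0 < w x := hw_pos x hx.1 (hx.2.trans_lt hl'R)
  have hwy : 0 < w y := hw_pos y hy.1 (hy.2.trans_lt hl'R)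
  have hd : 0 < R - l' := by linarith
  refine ⟨min (-w'R / 2) (w x / R), lt_min (by linarith) (by positivity),
    max (-2 * w'R) (w y / (R - l')), lt_max_of_lt_left (by linarith), fun r hr => ?_⟩
  have hdr : 0 < R - r := by linarith [hr.2]
  rcases le_or_gt r l' with h | h
  · have h1 : w x ≤ w r := hxmin ⟨hr.1.le, h⟩
    have h2 : w r ≤ w y := hymax ⟨hr.1.le, h⟩
    constructor
    · calc min (-w'R / 2) (w x / R) * (R - r) ≤ w x / R * R := by
            gcongr
            · exact min_le_right _ _
            · linarith [hr.1]
        _ = w x := by field_simp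
        _ ≤ w r := h1
    · calc w r ≤ w y := h2
        _ = w y / (R - l') * (R - l') := by field_simp
        _ ≤ max (-2 * w'R) (w y / (R - l')) * (R - r) := by
            gcongr
            exact le_max_right _ _
  · obtain ⟨h1, h2⟩ := (hlsub ⟨(le_max_left _ _).trans_lt h, hr.2⟩).1
    have e : slope w R r = -(w r / (R - r)) := by
      rw [slope_def_field, hwR, sub_zero, ← neg_sub R r, div_neg]
    rw [e] at h1 h2
    constructor
    · calc min (-w'R / 2) (w x / R) * (R - r) ≤ -w'R / 2 * (R - r) := by
            gcongr
            exact min_le_left _ _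
        _ ≤ w r := by
            rw [← le_div_iff₀ hdr]
            linarith
    · calc w r ≤ -2 * w'R * (R - r) := by
            rw [← div_le_iff₀ hdr]
            linarith
        _ ≤ _ := by
            gcongr
            exact le_max_left _ _

lemma exists_powWeightedEnergy_le_ofReal {R m s : ℝ} {w : ℝ → ℝ} (hm : 0 < m) (hs : 0 ≤ s)
    (hw : ∀ r ∈ Ioo 0 R, m * (R - r) ≤ w r) (N : ℕ) :
    ∃ C : NNReal, ∀ f : ℝ → ℝ,
      (∀ k < N, IntegrableOn (fun r => w r ^ (s + k) * r ^ 4 * iteratedDeriv k f r ^ 2)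
        (Ioo 0 R)) →
      powWeightedEnergy R s N f ≤ C * ENNReal.ofReal (∑ k ∈ Finset.range N,
        ∫ r in Ioo 0 R, w r ^ (s + k) * r ^ 4 * iteratedDeriv k f r ^ 2) := by
  refine ⟨∑ k ∈ Finset.range N, ((m ^ (s + k))⁻¹).toNNReal, fun f hf => ?_⟩
  have hpos : ∀ k : ℕ, ∀ r ∈ Ioo 0 R, 0 ≤ w r ^ (s + k) * r ^ 4 * iteratedDeriv k f r ^ 2 := by
    intro k r hr
    have : 0 ≤ w r := (mul_nonneg hm.le (by linarith [hr.2])).trans (hw r hr)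
    positivity
  have hI : ∀ k : ℕ, 0 ≤ ∫ r in Ioo 0 R, w r ^ (s + k) * r ^ 4 * iteratedDeriv k f r ^ 2 :=
    fun k => setIntegral_nonneg measurableSet_Ioo (hpos k)
  rw [ENNReal.ofNNReal_finsetSum, Finset.sum_mul]
  refine Finset.sum_le_sum fun k hk => ?_
  have hle : ENNReal.ofReal (∫ r in Ioo 0 R, w r ^ (s + k) * r ^ 4 * iteratedDeriv k f r ^ 2) ≤
      ENNReal.ofReal (∑ k ∈ Finset.range N,
        ∫ r in Ioo 0 R, w r ^ (s + k) * r ^ 4 * iteratedDeriv k f r ^ 2) :=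
    ENNReal.ofReal_le_ofReal (Finset.single_le_sum (f := fun k : ℕ =>
      ∫ r in Ioo 0 R, w r ^ (s + k) * r ^ 4 * iteratedDeriv k f r ^ 2) (fun k _ => hI k) hk)
  refine le_trans ?_ (mul_le_mul' le_rfl hle)
  rw [ofReal_integral_eq_lintegral_ofReal (hf k (Finset.mem_range.1 hk))
    ((ae_restrict_mem measurableSet_Ioo).mono (hpos k)), powWeightedSq,
    ← lintegral_const_mul' _ _ ENNReal.coe_ne_top]
  refine setLIntegral_mono' measurableSet_Ioo fun r hr => ?_
  change _ ≤ ENNReal.ofReal (m ^ (s + k))⁻¹ * _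
  rw [← ENNReal.ofReal_mul (by positivity)]
  apply ENNReal.ofReal_le_ofReal
  have hd : 0 ≤ R - r := by linarith [hr.2]
  have h1 : m ^ (s + k) * (R - r) ^ (s + k) ≤ w r ^ (s + k) := by
    rw [← mul_rpow hm.le hd]
    exact rpow_le_rpow (by positivity) (hw r hr) (by positivity)
  have h2 : (R - r) ^ (s + k) ≤ (m ^ (s + k))⁻¹ * w r ^ (s + k) := by
    rwa [le_inv_mul_iff₀ (by positivity)]
  have e : r ^ (4 : ℝ) = r ^ 4 := by norm_cast
  rw [e]
  calc r ^ 4 * (R - r) ^ (s + k) * iteratedDeriv k f r ^ 2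
      ≤ r ^ 4 * ((m ^ (s + k))⁻¹ * w r ^ (s + k)) * iteratedDeriv k f r ^ 2 := by gcongr
    _ = _ := by ring

/-- Weighted embeddings with extra weight `w^p`:
(1) `(sup_{0<r<R} w^{p/2} |u|)² ≤ C Σ_{k=0}^{⌈β⌉+2} ∫₀^R w^{β+p+k} r⁴ |∂_r^k u|² dr`;
(2) `∫₀^R w^p r⁴ u² dr ≤ C Σ_{k=0}^{⌈β⌉} ∫₀^R w^{β+p+k} r⁴ |∂_r^k u|² dr`. -/
theorem weighted_embeddings_extra_weight
    (α c R : ℝ) (hα : 3 < α) (hα' : α < 5) (hc : 0 < c) (hR : 0 < R)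
    (w : ℝ → ℝ)
    (hw_cont : ContinuousOn w (Set.Icc 0 R))
    (hw_smooth : ContDiffOn ℝ (⊤ : ℕ∞) w (Set.Ico 0 R))
    (hw0 : w 0 = 1) (hw'0 : deriv w 0 = 0)
    (hw_pos : ∀ r, 0 ≤ r → r < R → 0 < w r)
    (hwR : w R = 0)
    (hw_dec : ∀ r, 0 < r → r < R → deriv w r < 0)
    (hw_pv : ∃ w'R : ℝ, w'R < 0 ∧
      Filter.Tendsto (deriv w) (nhdsWithin R (Set.Iio R)) (nhds w'R))
    (hw_ode : ∀ r, 0 < r → r < R →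
      deriv (deriv w) r + (2 / r) * deriv w r + c * w r ^ α = 0)
    (p β : ℝ) (hp : 0 ≤ p) (hβ : 0 < β) :
    (1 ≤ ⌈β⌉₊ →
      ∃ C > (0:ℝ), ∀ u : ℝ → ℝ, ContDiffOn ℝ (⊤ : ℕ∞) u (Set.Ioo 0 R) →
        (∀ k ≤ ⌈β⌉₊ + 2,
          MeasureTheory.IntegrableOn
            (fun r => w r ^ (β + p + k) * r ^ 4 * (iteratedDeriv k u r) ^ 2)
            (Set.Ioo 0 R)) →
        ∀ r ∈ Set.Ioo (0:ℝ) R,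
          w r ^ p * (u r) ^ 2 ≤ C * ∑ k ∈ Finset.range (⌈β⌉₊ + 3),
            ∫ s in Set.Ioo (0:ℝ) R,
              w s ^ (β + p + k) * s ^ 4 * (iteratedDeriv k u s) ^ 2) ∧
    (∃ C > (0:ℝ), ∀ u : ℝ → ℝ, ContDiffOn ℝ (⊤ : ℕ∞) u (Set.Ioo 0 R) →
      (∀ k ≤ ⌈β⌉₊,
        MeasureTheory.IntegrableOn
          (fun r => w r ^ (β + p + k) * r ^ 4 * (iteratedDeriv k u r) ^ 2)
          (Set.Ioo 0 R)) →
      MeasureTheory.IntegrableOn (fun r => w r ^ p * r ^ 4 * (u r) ^ 2) (Set.Ioo 0 R) ∧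
      (∫ r in Set.Ioo (0:ℝ) R, w r ^ p * r ^ 4 * (u r) ^ 2) ≤
        C * ∑ k ∈ Finset.range (⌈β⌉₊ + 1),
          ∫ s in Set.Ioo (0:ℝ) R,
            w s ^ (β + p + k) * s ^ 4 * (iteratedDeriv k u s) ^ 2) := by
  obtain ⟨w'R, hneg, hlim⟩ := hw_pv
  have hw_contDiff : ContDiffOn ℝ (⊤ : ℕ∞) w (Ioo 0 R) := hw_smooth.mono Ioo_subset_Ico_self
  obtain ⟨m, hm, M, hM, hmM⟩ := exists_bounds_of_tendsto_deriv hR hw_cont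
    (hw_contDiff.differentiableOn (by simp)) hw_pos hwR hneg hlim
  have hwp : ∀ r ∈ Ioo 0 R, w r ^ p ≤ M ^ p * (R - r) ^ p := by
    intro r hr
    rw [← mul_rpow hM.le (by linarith [hr.2])]
    exact rpow_le_rpow (hw_pos r hr.1.le hr.2).le (hmM r hr).2 hp
  have hn : (⌈β⌉₊ : ℝ) < β + 1 := Nat.ceil_lt_add_one hβ.le
  have hn' : β ≤ ⌈β⌉₊ := Nat.le_ceil β
  have hsum : ∀ (N : ℕ) (u : ℝ → ℝ), 0 ≤ ∑ k ∈ Finset.range N, ∫ s in Ioo (0 : ℝ) R,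
      w s ^ (β + p + k) * s ^ 4 * (iteratedDeriv k u s) ^ 2 := fun N u =>
    Finset.sum_nonneg fun k _ => setIntegral_nonneg measurableSet_Ioo fun r hr =>
      mul_nonneg (mul_nonneg (rpow_nonneg (hw_pos r hr.1.le hr.2).le _)
        (pow_nonneg hr.1.le 4)) (sq_nonneg _)
  refine ⟨fun hceil => ?_, ?_⟩
  · obtain ⟨A, hA⟩ := exists_rpow_mul_sq_le_energy (R := R) (s := β + p) (p := p) hR hceil hp
      (by linarith) (by linarith) (by linarith)
    obtain ⟨B, hB⟩ := exists_powWeightedEnergy_le_ofReal (s := β + p) hm (by linarith)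
      (fun r hr => (hmM r hr).1) (⌈β⌉₊ + 3)
    refine ⟨M ^ p * (A * B) + 1, by positivity, fun u hu hint r hr => ?_⟩
    have h := (hA u hu r hr).trans
      (mul_le_mul' le_rfl (hB u fun k hk => hint k (Nat.lt_succ_iff.1 hk)))
    set S := ∑ k ∈ Finset.range (⌈β⌉₊ + 3), ∫ s in Ioo (0 : ℝ) R,
      w s ^ (β + p + k) * s ^ 4 * (iteratedDeriv k u s) ^ 2
    have hS : 0 ≤ S := hsum _ u
    rw [← mul_assoc, ← ENNReal.coe_mul, ← ENNReal.ofReal_coe_nnreal,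
      ← ENNReal.ofReal_mul (by positivity), ENNReal.ofReal_le_ofReal_iff (by positivity)] at h
    calc w r ^ p * u r ^ 2 ≤ M ^ p * (R - r) ^ p * u r ^ 2 :=
          mul_le_mul_of_nonneg_right (hwp r hr) (sq_nonneg _)
      _ = M ^ p * ((R - r) ^ p * u r ^ 2) := by ring
      _ ≤ M ^ p * ((A * B : NNReal) * S) := by gcongr
      _ ≤ _ := by push_cast; linarith
  · obtain ⟨A, hA⟩ := dominatedOnSmooth_powWeightedSq_energy (R := R) (s := β + p) (p := p)
      (n := ⌈β⌉₊) hR (by linarith) (by linarith)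
    obtain ⟨B, hB⟩ := exists_powWeightedEnergy_le_ofReal (s := β + p) hm (by linarith)
      (fun r hr => (hmM r hr).1) (⌈β⌉₊ + 1)
    refine ⟨M ^ p * (A * B) + 1, by positivity, fun u hu hint => ?_⟩
    have h := (hA u hu).trans
      (mul_le_mul' le_rfl (hB u fun k hk => hint k (Nat.lt_succ_iff.1 hk)))
    set S := ∑ k ∈ Finset.range (⌈β⌉₊ + 1), ∫ s in Ioo (0 : ℝ) R,
      w s ^ (β + p + k) * s ^ 4 * (iteratedDeriv k u s) ^ 2
    have hS : 0 ≤ S := hsum _ u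
    have hnn : 0 ≤ᵐ[volume.restrict (Ioo 0 R)] fun r => w r ^ p * r ^ 4 * u r ^ 2 :=
      (ae_restrict_mem measurableSet_Ioo).mono fun r hr =>
        mul_nonneg (mul_nonneg (rpow_nonneg (hw_pos r hr.1.le hr.2).le _)
          (pow_nonneg hr.1.le 4)) (sq_nonneg _)
    have hmeas : AEStronglyMeasurable (fun r => w r ^ p * r ^ 4 * u r ^ 2)
        (volume.restrict (Ioo 0 R)) := by
      refine ContinuousOn.aestronglyMeasurable ?_ measurableSet_Ioo
      exact ((hw_contDiff.continuousOn.rpow_const fun x _ => Or.inr hp).mul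
        (by fun_prop)).mul (hu.continuousOn.pow 2)
    have hlint : ∫⁻ r in Ioo 0 R, ENNReal.ofReal (w r ^ p * r ^ 4 * u r ^ 2) ≤
        ENNReal.ofReal (M ^ p * (A * B) * S) := by
      calc ∫⁻ r in Ioo 0 R, ENNReal.ofReal (w r ^ p * r ^ 4 * u r ^ 2)
          ≤ ∫⁻ r in Ioo 0 R, ENNReal.ofReal (M ^ p) *
              ENNReal.ofReal (r ^ (4 : ℝ) * (R - r) ^ p * u r ^ 2) := by
            refine setLIntegral_mono' measurableSet_Ioo fun r hr => ?_
            rw [← ENNReal.ofReal_mul (by positivity)]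
            apply ENNReal.ofReal_le_ofReal
            have e : r ^ (4 : ℝ) = r ^ 4 := by norm_cast
            rw [e]
            calc w r ^ p * r ^ 4 * u r ^ 2 ≤ (M ^ p * (R - r) ^ p) * r ^ 4 * u r ^ 2 := by
                  gcongr
                  exact hwp r hr
              _ = _ := by ring
        _ = ENNReal.ofReal (M ^ p) * powWeightedSq R 4 p u :=
            lintegral_const_mul' _ _ ENNReal.ofReal_ne_top
        _ ≤ ENNReal.ofReal (M ^ p) * (A * (B * ENNReal.ofReal S)) := mul_le_mul' le_rfl h
        _ = _ := by
            rw [ENNReal.ofReal_mul (by positivity), ENNReal.ofReal_mul (by positivity),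
              ENNReal.ofReal_mul (by positivity), ENNReal.ofReal_coe_nnreal,
              ENNReal.ofReal_coe_nnreal]
            ring
    refine ⟨⟨hmeas, (hasFiniteIntegral_iff_ofReal hnn).2
      (hlint.trans_lt ENNReal.ofReal_lt_top)⟩, ?_⟩
    rw [integral_eq_lintegral_of_nonneg_ae hnn hmeas]
    refine (ENNReal.toReal_le_of_le_ofReal (by positivity) hlint).trans ?_
    linarith
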